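/- For n = 30 and for every even integer n with 34 ≤ n ≤ 90, there exists a (3, 8) Hamiltonian bipartite graph of order n; that is, a simple graph on Fin n that is 3-regular, bipartite, contains a Hamiltonian cycle, and has girth 8. -/

import Mathlib

/-- A `(3, g)` Hamiltonian bipartite graph of order `n`: a simple graph on `Fin n` that is
3-regular (every vertex has exactly 3 neighbours), bipartite (2-colorable), contains a
Hamiltonian cycle, and has girth `g` (as the infimum in `ℕ∞` of its cycle lengths). -/
def IsHamBipartite3 (n g : ℕ) (G : SimpleGraph (Fin n)) : Prop :=
  (∀ v, {w | G.Adj v w}.ncard = 3) ∧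
  G.Colorable 2 ∧
  (∃ (v : Fin n) (c : G.Walk v v), c.IsHamiltonianCycle) ∧
  G.egirth = (g : ℕ∞)

/-! Each graph is given by a Hamiltonian cycle `0, 1, …, n - 1` together with a perfect matching of
chords; the chord partner of `v` is the `v`-th digit of a number `T` in base `128`. -/

namespace HamCage

open SimpleGraph

/-- Successor on the Hamiltonian cycle. -/
def nx (n v : ℕ) : ℕ := (v + 1) % n

/-- Predecessor on the Hamiltonian cycle. -/
def pv (n v : ℕ) : ℕ := (v + (n - 1)) % n

/-- The `v`-th digit of `T` in base `128`. -/
def ch (T v : ℕ) : ℕ := T / 128 ^ v % 128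

/-- Bounded universal quantifier. -/
def allB (p : ℕ → Bool) : ℕ → Bool
  | 0 => true
  | k + 1 => p k && allB p k

/-- `p` holds at the three neighbours of `v`. -/
def all3 (n T v : ℕ) (p : ℕ → Bool) : Bool := p (nx n v) && (p (pv n v) && p (ch T v))

/-- Adjacency. -/
def adjB (n T v w : ℕ) : Bool := Nat.beq w (nx n v) || (Nat.beq w (pv n v) || Nat.beq w (ch T v))

/-- No non-backtracking walk with `k` more steps ends at `s`. -/
def nb (n T s : ℕ) : ℕ → ℕ → ℕ → Bool
  | 0, _, c => !(Nat.beq c s)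
  | k + 1, p, c => all3 n T c fun w => Nat.beq w p || nb n T s k c w

/-- Conditions on the chords at `v`. -/
def okV (n T v : ℕ) : Bool :=
  Nat.ble (ch T v + 1) n && (Nat.beq (ch T (ch T v)) v &&
    (Nat.beq ((ch T v + v) % 2) 1 && (!(Nat.beq (ch T v) (nx n v)) && !(Nat.beq (ch T v) (pv n v)))))

/-- No short cycles through `v`. -/
def girthV (n T v : ℕ) : Bool :=
  all3 n T v fun w => nb n T v 3 v w && nb n T v 5 v w

/-- The digits of `C` form an 8-cycle. -/
def okC (n T C : ℕ) : Bool :=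
  allB (fun i => Nat.ble (ch C i + 1) n && (adjB n T (ch C i) (ch C ((i + 1) % 8)) &&
    allB (fun j => Nat.beq i j || !(Nat.beq (ch C i) (ch C j))) 8)) 8

/-- The complete check. -/
def good (n T C : ℕ) : Bool :=
  Nat.beq (n % 2) 0 && (Nat.ble 3 n && (allB (okV n T) n && (allB (girthV n T) n && okC n T C)))

theorem allB_iff (p : ℕ → Bool) (n : ℕ) : allB p n = true ↔ ∀ i < n, p i = true := by
  induction n with
  | zero => simp [allB]
  | succ k ih =>
    simp only [allB, Bool.and_eq_true, ih]
    constructor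
    · rintro ⟨h1, h2⟩ i hi
      rcases Nat.lt_succ_iff_lt_or_eq.mp hi with h | h
      · exact h2 i h
      · exact h ▸ h1
    · intro h
      exact ⟨h k (by omega), fun i hi => h i (by omega)⟩

theorem adjB_iff (n T v w : ℕ) :
    adjB n T v w = true ↔ w = nx n v ∨ w = pv n v ∨ w = ch T v := by
  simp [adjB, Nat.beq_eq]

theorem all3_adj {n T v w : ℕ} {p : ℕ → Bool} (h : all3 n T v p = true)
    (hw : adjB n T v w = true) : p w = true := by
  simp only [all3, Bool.and_eq_true] at h
  rw [adjB_iff] at hw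
  rcases hw with rfl | rfl | rfl
  exacts [h.1, h.2.1, h.2.2]

theorem nb_step {n T s k p c w : ℕ} (h : nb n T s (k + 1) p c = true)
    (hw : adjB n T c w = true) (hne : w ≠ p) : nb n T s k c w = true := by
  have := all3_adj h hw
  simpa [Nat.beq_eq, hne] using this

theorem beq_false_iff (a b : ℕ) : Nat.beq a b = false ↔ a ≠ b := by
  rw [← Bool.not_eq_true, Nat.beq_eq]

theorem nb_end {n T s p c : ℕ} (h : nb n T s 0 p c = true) : c ≠ s := by
  simpa [nb, beq_false_iff] using h

theorem nx_eq {n v : ℕ} (hv : v < n) : nx n v = if v + 1 = n then 0 else v + 1 := by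
  unfold nx
  split_ifs with h
  · rw [h, Nat.mod_self]
  · exact Nat.mod_eq_of_lt (by omega)

theorem pv_eq {n v : ℕ} (hv : v < n) : pv n v = if v = 0 then n - 1 else v - 1 := by
  unfold pv
  split_ifs with h
  · subst h
    rw [Nat.zero_add]
    exact Nat.mod_eq_of_lt (by omega)
  · have : v + (n - 1) = (v - 1) + n := by omega
    rw [this, Nat.add_mod_right]
    exact Nat.mod_eq_of_lt (by omega)

theorem exists_of_good {n T C : ℕ} (hg : good n T C = true) :
    ∃ G : SimpleGraph (Fin n), IsHamBipartite3 n 8 G := by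
  simp only [good, Bool.and_eq_true, Nat.beq_eq, allB_iff, Nat.ble_eq] at hg
  obtain ⟨hpar, hn3, hok, hgir, hC⟩ := hg
  have hok' : ∀ v < n, ch T v < n ∧ ch T (ch T v) = v ∧ (ch T v + v) % 2 = 1 ∧
      ch T v ≠ nx n v ∧ ch T v ≠ pv n v := by
    intro v hv
    have := hok v hv
    simpa [okV, Nat.beq_eq, beq_false_iff, Nat.succ_le_iff] using this
  have hpar' : ∀ v < n, ∀ w, adjB n T v w = true → w < n ∧ (v + w) % 2 = 1 := by
    intro v hv w h
    rw [adjB_iff, nx_eq hv, pv_eq hv] at h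
    have := hok' v hv
    rcases h with h | h | h <;> (try split_ifs at h) <;> omega
  have hsymm : ∀ v < n, ∀ w < n, adjB n T v w = true → adjB n T w v = true := by
    intro v hv w hw h
    rw [adjB_iff, nx_eq hv, pv_eq hv] at h
    rw [adjB_iff, nx_eq hw, pv_eq hw]
    rcases h with h | h | h
    · right; left; split_ifs at h ⊢ <;> omega
    · left; split_ifs at h ⊢ <;> omega
    · right; right; rw [h]; exact (hok' v hv).2.1.symm
  let G : SimpleGraph (Fin n) :=
    { Adj := fun v w => adjB n T v w = true
      symm := ⟨fun v w h => hsymm v v.2 w w.2 h⟩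
      loopless := ⟨fun v h => by have := (hpar' v v.2 v h).2; omega⟩ }
  have hadj : ∀ v w, G.Adj v w ↔ adjB n T v w = true := fun v w => Iff.rfl
  have hcol : G.Coloring Bool := SimpleGraph.Coloring.mk (fun v => decide ((v : ℕ) % 2 = 0)) (by
    intro v w h heq
    have := (hpar' v v.2 w h).2
    simp only [decide_eq_decide] at heq
    omega)
  refine ⟨G, ?_, ?_, ?_, ?_⟩
  · intro v
    obtain ⟨h1, h2, h3, h4, h5⟩ := hok' v v.2
    have hx : nx n v < n := Nat.mod_lt _ (by omega)
    have hp : pv n v < n := Nat.mod_lt _ (by omega)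
    have hxp : nx n v ≠ pv n v := by
      rw [nx_eq v.2, pv_eq v.2]
      split_ifs <;> omega
    rw [Set.ncard_eq_three]
    refine ⟨⟨_, hx⟩, ⟨_, hp⟩, ⟨_, h1⟩, ?_, ?_, ?_, ?_⟩
    · simpa [Fin.ext_iff] using hxp
    · simpa [Fin.ext_iff] using h4.symm
    · simpa [Fin.ext_iff] using h5.symm
    · ext w
      simp [hadj, adjB_iff, Fin.ext_iff]
  · simpa using hcol.colorable
  · have hle : cycleGraph n ≤ G := by
      intro v w h
      rw [hadj, adjB_iff, nx_eq v.2, pv_eq v.2]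
      rw [cycleGraph_adj', Fin.sub_def, Fin.sub_def] at h
      simp only at h
      have hv := v.2
      have hw := w.2
      rcases h with h | h
      · right; left
        by_cases hvw : (w : ℕ) ≤ v
        · rw [show n - (w : ℕ) + v = (v - w) + n by omega, Nat.add_mod_right,
            Nat.mod_eq_of_lt (by omega)] at h
          split_ifs <;> omega
        · rw [Nat.mod_eq_of_lt (by omega)] at h
          split_ifs <;> omega
      · left
        by_cases hvw : (v : ℕ) ≤ w
        · rw [show n - (v : ℕ) + w = (w - v) + n by omega, Nat.add_mod_right,
            Nat.mod_eq_of_lt (by omega)] at h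
          split_ifs <;> omega
        · rw [Nat.mod_eq_of_lt (by omega)] at h
          split_ifs <;> omega
    obtain ⟨v, p, hp, hl⟩ := (cycleGraph_isContained_iff (G := G) (by omega : 2 < n)).mp
      (IsContained.of_le hle)
    exact ⟨v, p, Walk.isHamiltonianCycle_iff_isCycle_and_length_eq.mpr ⟨hp, by simpa using hl⟩⟩
  · apply le_antisymm
    · simp only [okC, Bool.and_eq_true, allB_iff, Nat.ble_eq] at hC
      have hcont : cycleGraph 8 ⊑ G := by
        let f : Fin 8 → Fin n := fun i => ⟨ch C i, (hC i i.2).1⟩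
        have hf : Function.Injective f := by
          intro i j hij
          have h := (hC i i.2).2.2 j j.2
          simp only [f, Fin.mk.injEq] at hij
          simp only [Bool.or_eq_true, Nat.beq_eq, Bool.not_eq_true', hij] at h
          rcases h with h | h
          · exact Fin.ext h
          · simp at h
        have hs : ∀ i : Fin 8, G.Adj (f i) (f (i + 1)) := by
          intro i
          have h := (hC i i.2).2.1
          rw [hadj]
          simpa [f, Fin.val_add] using h
        refine ⟨⟨⟨f, ?_⟩, hf⟩⟩
        intro i j h
        rw [cycleGraph_adj] at h
        rcases h with h | h
        · rw [sub_eq_iff_eq_add'] at h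
          subst h
          exact (hs j).symm
        · rw [sub_eq_iff_eq_add'] at h
          subst h
          exact hs i
      obtain ⟨v, p, hp, hl⟩ := (cycleGraph_isContained_iff (G := G) (by omega : 2 < 8)).mp hcont
      have := egirth_le_length hp
      rwa [hl] at this
    · rw [le_egirth]
      intro a w hw
      by_contra hlt
      have hlt' : w.length < 8 := by
        rw [not_le] at hlt
        exact_mod_cast hlt
      have h3 := hw.three_le_length
      have hev : Even w.length := (hcol.even_length_iff_congr w).mpr Iff.rfl
      have ha : ∀ i < w.length, adjB n T (w.getVert i) (w.getVert (i + 1)) = true :=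
        fun i hi => w.adj_getVert_succ hi
      have hb : ∀ i, i + 2 ≤ w.length →
          (w.getVert (i + 2) : ℕ) ≠ (w.getVert i : ℕ) := by
        intro i hi h
        have := hw.getVert_sub_one_ne_getVert_add_one (i := i + 1) (by omega)
        exact this (Fin.ext h.symm)
      have h0 : w.getVert 0 = a := w.getVert_zero
      have hl : w.getVert w.length = a := w.getVert_length
      have hst := all3_adj (hgir _ (w.getVert 0).2) (ha 0 (by omega))
      rw [Bool.and_eq_true] at hst
      have h46 : w.length = 4 ∨ w.length = 6 := by
        obtain ⟨r, hr⟩ := hev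
        omega
      rcases h46 with h | h <;> rw [h] at ha hb hl
      · have h1 := nb_step hst.1 (ha 1 (by omega)) (hb 0 (by omega))
        have h2 := nb_step h1 (ha 2 (by omega)) (hb 1 (by omega))
        have h3 := nb_step h2 (ha 3 (by omega)) (hb 2 (by omega))
        apply nb_end h3
        simp only [Nat.reduceAdd]
        rw [hl, h0]
      · have h1 := nb_step hst.2 (ha 1 (by omega)) (hb 0 (by omega))
        have h2 := nb_step h1 (ha 2 (by omega)) (hb 1 (by omega))
        have h3 := nb_step h2 (ha 3 (by omega)) (hb 2 (by omega))
        have h4 := nb_step h3 (ha 4 (by omega)) (hb 3 (by omega))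
        have h5 := nb_step h4 (ha 5 (by omega)) (hb 4 (by omega))
        apply nb_end h5
        simp only [Nat.reduceAdd]
        rw [hl, h0]

theorem ex_30 : ∃ G : SimpleGraph (Fin 30), IsHamBipartite3 30 8 G :=
  exists_of_good (n := 30)
    (T := 154984799557892254224858450579547020200658180593378921642347281)
    (C := 9649486924120192)
    (by decide +kernel)

theorem ex_34 : ∃ G : SimpleGraph (Fin 34), IsHamBipartite3 34 8 G :=
  exists_of_good (n := 34)
    (T := 28070367854414449029959563205171182813201465106027534278898541689981453)
    (C := 7380438521774208)
    (by decide +kernel)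

theorem ex_36 : ∃ G : SimpleGraph (Fin 36), IsHamBipartite3 36 8 G :=
  exists_of_good (n := 36)
    (T := 460753770311998401127621884479592430559830066209583524694939306198021981719)
    (C := 13044778830692480)
    (by decide +kernel)

theorem ex_38 : ∃ G : SimpleGraph (Fin 38), IsHamBipartite3 38 8 G :=
  exists_of_good (n := 38)
    (T := 20589853857960769423777798104445299500704472820343815096397605143025290288744455)
    (C := 3967210831773824)
    (by decide +kernel)

theorem ex_40 : ∃ G : SimpleGraph (Fin 40), IsHamBipartite3 40 8 G :=
  exists_of_good (n := 40)
    (T := 487686818479508656931697116849276505405316704388177266692421679407254596608931972631)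
    (C := 13044778830692480)
    (by decide +kernel)

theorem ex_42 : ∃ G : SimpleGraph (Fin 42), IsHamBipartite3 42 8 G :=
  exists_of_good (n := 42)
    (T := 8009958579984414098042077763108237409769695010033585352572178966066516675270853444096531)
    (C := 10784182923985024)
    (by decide +kernel)

theorem ex_44 : ∃ G : SimpleGraph (Fin 44), IsHamBipartite3 44 8 G :=
  exists_of_good (n := 44)
    (T := 90617785875460814186913658929202771974172493456492875021751601854629373729754737609965585435)
    (C := 15322966923444352)
    (by decide +kernel)

theorem ex_46 : ∃ G : SimpleGraph (Fin 46), IsHamBipartite3 46 8 G :=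
  exists_of_good (n := 46)
    (T := 1751680947651557078115719877718801269591136435567658428517736122074660868706302909691444339100433)
    (C := 9650457049858176)
    (by decide +kernel)

theorem ex_48 : ∃ G : SimpleGraph (Fin 48), IsHamBipartite3 48 8 G :=
  exists_of_good (n := 48)
    (T := 39500680509544677405553604777126352190869303466934126481479803983740029455992869753329755241660696105)
    (C := 23267144592556160)
    (by decide +kernel)

theorem ex_50 : ∃ G : SimpleGraph (Fin 50), IsHamBipartite3 50 8 G :=
  exists_of_good (n := 50)
    (T := 111022824158933929213101298345712659542420830696770052436439362384027701638930159265658318521042939004193)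
    (C := 27611108875468928)
    (by decide +kernel)

theorem ex_52 : ∃ G : SimpleGraph (Fin 52), IsHamBipartite3 52 8 G :=
  exists_of_good (n := 52)
    (T := 11231550956448669842238562759885796854061932950190282516887463398801315786967293855065043555866097569982205703)
    (C := 3967210831773824)
    (by decide +kernel)

theorem ex_54 : ∃ G : SimpleGraph (Fin 54), IsHamBipartite3 54 8 G :=
  exists_of_good (n := 54)
    (T := 30110685565997302921989792691557574752837311363697785372027758761116726273313045325023242036815484599698467670831)
    (C := 29862908689154176)
    (by decide +kernel)

theorem ex_56 : ∃ G : SimpleGraph (Fin 56), IsHamBipartite3 56 8 G :=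
  exists_of_good (n := 56)
    (T := 1754082980126629262862844313617493232018397627470894905913599317364252210690576986344452265490362488771289763086030373)
    (C := 31059731390955648)
    (by decide +kernel)

theorem ex_58 : ∃ G : SimpleGraph (Fin 58), IsHamBipartite3 58 8 G :=
  exists_of_good (n := 58)
    (T := 20933499767645075876765718647920495541359461273905931785122728943603799504581634460295326766130914240675937158980489008405)
    (C := 32336342237085824)
    (by decide +kernel)

theorem ex_60 : ∃ G : SimpleGraph (Fin 60), IsHamBipartite3 60 8 G :=
  exists_of_good (n := 60)
    (T := 893275592805190112692563556403061222794266958543348947041655617185546329185909910278523663864989722624299015934573301728072205)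
    (C := 7381619201572992)
    (by decide +kernel)

theorem ex_62 : ∃ G : SimpleGraph (Fin 62), IsHamBipartite3 62 8 G :=
  exists_of_good (n := 62)
    (T := 18144753990592840575236233088730824247256558841572097190310520083222480001724730626272677453281244266989946574529394382269577808653)
    (C := 34570411352031360)
    (by decide +kernel)

theorem ex_64 : ∃ G : SimpleGraph (Fin 64), IsHamBipartite3 64 8 G :=
  exists_of_good (n := 64)
    (T := 161363221674111157671899786174194121337821417853250906733682669767746538425241928726290574813723987618419972423291835619850003934008609)
    (C := 18728094305124480)
    (by decide +kernel)

theorem ex_66 : ∃ G : SimpleGraph (Fin 66), IsHamBipartite3 66 8 G :=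
  exists_of_good (n := 66)
    (T := 4122097739381180696625695335978738522759643155588958758696139205713627607971704855096672672659855919106497294830847861446657054029417726997)
    (C := 36874572722634880)
    (by decide +kernel)

theorem ex_68 : ∃ G : SimpleGraph (Fin 68), IsHamBipartite3 68 8 G :=
  exists_of_good (n := 68)
    (T := 70606956318715551214653603005766713565516449184554335755177252324245632841216910890571283306371673375396523343070691149456541466378658424478781)
    (C := 34604002828124288)
    (by decide +kernel)

theorem ex_70 : ∃ G : SimpleGraph (Fin 70), IsHamBipartite3 70 8 G :=
  exists_of_good (n := 70)
    (T := 405312759964302965998866739805995215645817973422766780741640033944229935541002975221892662452337172839906684135895606661473519422676882697184763915)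
    (C := 6238264983847040)
    (by decide +kernel)

theorem ex_72 : ∃ G : SimpleGraph (Fin 72), IsHamBipartite3 72 8 G :=
  exists_of_good (n := 72)
    (T := 25475569714371374794535324240117087737867036904353830919682860146602366232563932303443943655878321820950976313190707133770470907940730154240551235803949)
    (C := 40278452416315520)
    (by decide +kernel)

theorem ex_74 : ∃ G : SimpleGraph (Fin 74), IsHamBipartite3 74 8 G :=
  exists_of_good (n := 74)
    (T := 443885707170402164136676374225070988736645756596339286070487779309429984221130285642297085406028691066718114802813088910419651393689940879753762684674333243)
    (C := 33470692492083328)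
    (by decide +kernel)

theorem ex_76 : ∃ G : SimpleGraph (Fin 76), IsHamBipartite3 76 8 G :=
  exists_of_good (n := 76)
    (T := 5549696128724202410546229739306914202399627296315825445829418971869781929628870026879002674817460034389424610422268326828614540291049853994989160139377186005767)
    (C := 3967210831773824)
    (by decide +kernel)

theorem ex_78 : ∃ G : SimpleGraph (Fin 78), IsHamBipartite3 78 8 G :=
  exists_of_good (n := 78)
    (T := 29145884444875652084801655843796221924310060385933093492325951888750587897261644991226562691301712152476081971865130114837470559508696056929896921135506099821762847)
    (C := 17593674873471104)
    (by decide +kernel)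

theorem ex_80 : ∃ G : SimpleGraph (Fin 80), IsHamBipartite3 80 8 G :=
  exists_of_good (n := 80)
    (T := 538902377268453066267693306639400041864235450828399096348941060800091431254187910086799635828474125884728673807762441153991705513340871998501706517354271157265734786883)
    (C := 38019085943996544)
    (by decide +kernel)

theorem ex_82 : ∃ G : SimpleGraph (Fin 82), IsHamBipartite3 82 8 G :=
  exists_of_good (n := 82)
    (T := 4851263662599750177825381012054374240176159700503559951420386220427249127484682431345027821455297592145383679013031304229321319961380696875846255446336440863950669611918403)
    (C := 45950962826772608)
    (by decide +kernel)

theorem ex_84 : ∃ G : SimpleGraph (Fin 84), IsHamBipartite3 84 8 G :=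
  exists_of_good (n := 84)
    (T := 492763530551313546946368852759884488089890670652826240526071786136742427547196128389666456742367568252296062498740581295043248914782116610461987820586306509099873018917867906889)
    (C := 47088290728476800)
    (by decide +kernel)

theorem ex_86 : ∃ G : SimpleGraph (Fin 86), IsHamBipartite3 86 8 G :=
  exists_of_good (n := 86)
    (T := 3686577181683389073559514433868492931076419900712097806814574502128547931113987842297177751578649778318041700821335459540801301840894154509679560958458459286679274337093472738072635)
    (C := 48223034886094976)
    (by decide +kernel)

theorem ex_88 : ∃ G : SimpleGraph (Fin 88), IsHamBipartite3 88 8 G :=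
  exists_of_good (n := 88)
    (T := 123482329246159238239459228554832244028154188684225137654736532575779353124268592018005294493040405702306998399396100450439843563021964832446069444376451624886033305465812993097155042067)
    (C := 49233706298998912)
    (by decide +kernel)

theorem ex_90 : ∃ G : SimpleGraph (Fin 90), IsHamBipartite3 90 8 G :=
  exists_of_good (n := 90)
    (T := 2791016545012766103186952552615398386435952034476980802450340727361963457664627047121452285115695686379755123160425175610624433604802150743093198240488665108583878863314931460693796634745925)
    (C := 39144034092843136)
    (by decide +kernel)

end HamCage

/-- A `(3, 8)` Hamiltonian bipartite graph exists of order `30` and of every even order `n`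
with `34 ≤ n ≤ 90`. -/
theorem stmt_9 :
    (∃ G : SimpleGraph (Fin 30), IsHamBipartite3 30 8 G) ∧
    (∀ n : ℕ, 34 ≤ n → n ≤ 90 → Even n →
      ∃ G : SimpleGraph (Fin n), IsHamBipartite3 n 8 G) := by
  refine ⟨HamCage.ex_30, fun n h1 h2 he => ?_⟩
  obtain ⟨k, rfl⟩ := he
  have hk1 : 17 ≤ k := by omega
  have hk2 : k ≤ 45 := by omega
  interval_cases k
  · exact HamCage.ex_34
  · exact HamCage.ex_36
  · exact HamCage.ex_38
  · exact HamCage.ex_40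
  · exact HamCage.ex_42
  · exact HamCage.ex_44
  · exact HamCage.ex_46
  · exact HamCage.ex_48
  · exact HamCage.ex_50
  · exact HamCage.ex_52
  · exact HamCage.ex_54
  · exact HamCage.ex_56
  · exact HamCage.ex_58
  · exact HamCage.ex_60
  · exact HamCage.ex_62
  · exact HamCage.ex_64
  · exact HamCage.ex_66
  · exact HamCage.ex_68
  · exact HamCage.ex_70
  · exact HamCage.ex_72
  · exact HamCage.ex_74
  · exact HamCage.ex_76
  · exact HamCage.ex_78
  · exact HamCage.ex_80
  · exact HamCage.ex_82
  · exact HamCage.ex_84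
  · exact HamCage.ex_86
  · exact HamCage.ex_88
  · exact HamCage.ex_90
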